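/- (Uniqueness of the minimal-entropy Π over the optimal set.) Suppose the WBM feasible set B is nonempty and let 𝓜 denote the set of minimizers of f over B. If (w₁, Π₁, r₁) ∈ 𝓜 and (w₂, Π₂, r₂) ∈ 𝓜 both minimize the entropy functional H(Π) = ∑ i, ∑ j, Π i j * Real.log (Π i j) among all elements of 𝓜, then Π₁ = Π₂. -/

import Mathlib

open Finset

/-- A conditional distribution (channel) from `Fin M` to `Fin N`. -/
def CondDist {M N : ℕ} (w : Fin M → Fin N → ℝ) : Prop :=
  (∀ i j, w i j ≥ 0) ∧ (∀ i, ∑ j, w i j = 1)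

/-- A coupling of `(r, p)`. -/
def Coupling {M N : ℕ} (r : Fin N → ℝ) (p : Fin M → ℝ)
    (Pi : Fin M → Fin N → ℝ) : Prop :=
  (∀ i j, Pi i j ≥ 0) ∧ (∀ j, ∑ i, Pi i j = r j) ∧ (∀ i, ∑ j, Pi i j = p i)

/-- The objective of the RDP problem (with the convention `Real.log 0 = 0`). -/
noncomputable def fObj {M N : ℕ} (p : Fin M → ℝ)
    (w : Fin M → Fin N → ℝ) (r : Fin N → ℝ) : ℝ :=
  ∑ i, ∑ j, w i j * p i * (Real.log (w i j) - Real.log (r j))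

/-- The Wasserstein perception between `p` and `r` with cost `c`. -/
noncomputable def Wass {M N : ℕ} (p : Fin M → ℝ) (r : Fin N → ℝ)
    (c : Fin M → Fin N → ℝ) : ℝ :=
  sInf {v : ℝ | ∃ Pi : Fin M → Fin N → ℝ,
    Coupling r p Pi ∧ v = ∑ i, ∑ j, Pi i j * c i j}

/-- The RDP feasible set `A`. -/
noncomputable def memA {M N : ℕ} (p : Fin M → ℝ) (d c : Fin M → Fin N → ℝ) (D P : ℝ)
    (w : Fin M → Fin N → ℝ) (r : Fin N → ℝ) : Prop :=
  CondDist w ∧ (∀ j, r j = ∑ i, w i j * p i) ∧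
    (∑ i, ∑ j, w i j * p i * d i j ≤ D) ∧ Wass p r c ≤ P

/-- The WBM feasible set `B`. -/
def memB {M N : ℕ} (p : Fin M → ℝ) (d c : Fin M → Fin N → ℝ) (D P : ℝ)
    (w Pi : Fin M → Fin N → ℝ) (r : Fin N → ℝ) : Prop :=
  CondDist w ∧ (∀ j, r j = ∑ i, w i j * p i) ∧ Coupling r p Pi ∧
    (∑ i, ∑ j, w i j * p i * d i j ≤ D) ∧ (∑ i, ∑ j, Pi i j * c i j ≤ P)

theorem aux_one (a x S T : ℝ) (ha : 0 ≤ a) (hx : 0 ≤ x) (h : x = 0 → a = 0)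
    (hS : 0 < S) (hT : 0 < T) :
    a * (Real.log S - Real.log T) + a - S * x / T ≤ a * (Real.log a - Real.log x) := by
  rcases ha.eq_or_lt with h0 | h0
  · subst h0
    have : 0 ≤ S * x / T := by positivity
    linarith
  · have hx0 : 0 < x := lt_of_le_of_ne hx (fun e => h0.ne' (h e.symm))
    have h1 := Real.log_le_sub_one_of_pos (show 0 < S * x / (a * T) by positivity)
    rw [Real.log_div (by positivity) (by positivity), Real.log_mul hS.ne' hx0.ne',
      Real.log_mul h0.ne' hT.ne'] at h1
    have h2 := mul_le_mul_of_nonneg_left h1 ha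
    have h3 : a * (S * x / (a * T) - 1) = S * x / T - a := by field_simp
    rw [h3] at h2
    linarith

theorem aux_two (a b x y : ℝ) (ha : 0 ≤ a) (hb : 0 ≤ b) (hx : 0 ≤ x) (hy : 0 ≤ y)
    (h : x = 0 → a = 0) (h' : y = 0 → b = 0) :
    ((a + b) / 2) * (Real.log ((a + b) / 2) - Real.log ((x + y) / 2)) ≤
      (a * (Real.log a - Real.log x) + b * (Real.log b - Real.log y)) / 2 := by
  rcases (add_nonneg ha hb).eq_or_lt with h0 | h0
  · have e1 : a = 0 := by linarith
    have e2 : b = 0 := by linarith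
    subst e1 e2
    simp
  · have hT : 0 < x + y := by
      rcases (add_nonneg hx hy).eq_or_lt with h1 | h1
      · have := h (by linarith)
        have := h' (by linarith)
        linarith
      · exact h1
    have k1 := aux_one a x ((a + b) / 2) ((x + y) / 2) ha hx h (by linarith) (by linarith)
    have k2 := aux_one b y ((a + b) / 2) ((x + y) / 2) hb hy h' (by linarith) (by linarith)
    have k3 : (a + b) / 2 * x / ((x + y) / 2) + (a + b) / 2 * y / ((x + y) / 2) = a + b := by
      field_simp
    linarith

theorem aux_fObj {M N : ℕ} (p : Fin M → ℝ) (hp : ∀ i, p i ≥ 0)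
    (w₁ w₂ : Fin M → Fin N → ℝ) (r₁ r₂ : Fin N → ℝ)
    (h₁ : ∀ i j, w₁ i j ≥ 0) (h₂ : ∀ i j, w₂ i j ≥ 0)
    (hr₁ : ∀ j, r₁ j = ∑ i, w₁ i j * p i) (hr₂ : ∀ j, r₂ j = ∑ i, w₂ i j * p i) :
    fObj p (fun i j => (w₁ i j + w₂ i j) / 2) (fun j => (r₁ j + r₂ j) / 2) ≤
      (fObj p w₁ r₁ + fObj p w₂ r₂) / 2 := by
  have key : ∀ (w : Fin M → Fin N → ℝ) (r : Fin N → ℝ), (∀ i j, w i j ≥ 0) →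
      (∀ j, r j = ∑ i, w i j * p i) → ∀ i j, 0 ≤ r j ∧ (0 < p i → r j = 0 → w i j = 0) := by
    intro w r hw hr i j
    have hn : ∀ i ∈ univ, 0 ≤ w i j * p i := fun i _ => mul_nonneg (hw i j) (hp i)
    refine ⟨by rw [hr]; exact sum_nonneg hn, fun h0 h1 => ?_⟩
    rw [hr, sum_eq_zero_iff_of_nonneg hn] at h1
    exact (mul_eq_zero.1 (h1 i (mem_univ i))).resolve_right h0.ne'
  unfold fObj
  rw [← sum_add_distrib, sum_div]
  refine sum_le_sum fun i _ => ?_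
  rw [← sum_add_distrib, sum_div]
  refine sum_le_sum fun j _ => ?_
  rcases (hp i).le.eq_or_lt with h0 | h0
  · simp [← h0]
  · obtain ⟨a1, a2⟩ := key w₁ r₁ h₁ hr₁ i j
    obtain ⟨b1, b2⟩ := key w₂ r₂ h₂ hr₂ i j
    have := mul_le_mul_of_nonneg_left
      (aux_two _ _ _ _ (h₁ i j) (h₂ i j) a1 b1 (a2 h0) (b2 h0)) h0.le
    linarith

theorem aux_sum {M N : ℕ} (A B C : Fin M → Fin N → ℝ) :
    ∑ i, ∑ j, (A i j + B i j) / 2 * C i j =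
      (∑ i, ∑ j, A i j * C i j + ∑ i, ∑ j, B i j * C i j) / 2 := by
  simp only [← sum_add_distrib, sum_div]
  exact sum_congr rfl fun i _ => sum_congr rfl fun j _ => by ring

theorem aux_memB {M N : ℕ} (p : Fin M → ℝ) (d c : Fin M → Fin N → ℝ) (D P : ℝ)
    (w₁ Pi₁ w₂ Pi₂ : Fin M → Fin N → ℝ) (r₁ r₂ : Fin N → ℝ)
    (h₁ : memB p d c D P w₁ Pi₁ r₁) (h₂ : memB p d c D P w₂ Pi₂ r₂) :
    memB p d c D P (fun i j => (w₁ i j + w₂ i j) / 2) (fun i j => (Pi₁ i j + Pi₂ i j) / 2)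
      (fun j => (r₁ j + r₂ j) / 2) := by
  obtain ⟨⟨a1, a2⟩, a3, ⟨a4, a5, a6⟩, a7, a8⟩ := h₁
  obtain ⟨⟨b1, b2⟩, b3, ⟨b4, b5, b6⟩, b7, b8⟩ := h₂
  refine ⟨⟨fun i j => ?_, fun i => ?_⟩, fun j => ?_,
    ⟨fun i j => ?_, fun j => ?_, fun i => ?_⟩, ?_, ?_⟩
  · have := a1 i j
    have := b1 i j
    dsimp only
    linarith
  · dsimp only
    rw [← sum_div, sum_add_distrib, a2, b2]
    norm_num
  · dsimp only
    rw [a3, b3, ← sum_add_distrib, sum_div]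
    exact sum_congr rfl fun i _ => by ring
  · have := a4 i j
    have := b4 i j
    dsimp only
    linarith
  · dsimp only
    rw [← sum_div, sum_add_distrib, a5, b5]
  · dsimp only
    rw [← sum_div, sum_add_distrib, a6, b6]
    ring
  · have := aux_sum w₁ w₂ (fun i j => p i * d i j)
    simp only [← mul_assoc] at this
    rw [this]
    linarith
  · dsimp only
    rw [aux_sum]
    linarith

theorem aux_ent (a b : ℝ) (ha : 0 ≤ a) (hb : 0 ≤ b) :
    (a + b) / 2 * Real.log ((a + b) / 2) ≤ (a * Real.log a + b * Real.log b) / 2 ∧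
    (a ≠ b →
      (a + b) / 2 * Real.log ((a + b) / 2) < (a * Real.log a + b * Real.log b) / 2) := by
  have hs : a ≠ b →
      (a + b) / 2 * Real.log ((a + b) / 2) < (a * Real.log a + b * Real.log b) / 2 := by
    intro h
    have := Real.strictConvexOn_mul_log.2 (Set.mem_Ici.2 ha) (Set.mem_Ici.2 hb) h
      (show (0:ℝ) < 1/2 by norm_num) (show (0:ℝ) < 1/2 by norm_num) (by norm_num)
    simp only [smul_eq_mul] at this
    rw [show 1/2 * a + 1/2 * b = (a + b) / 2 by ring] at this
    linarith
  refine ⟨?_, hs⟩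
  by_cases h : a = b
  · subst h
    simp
  · exact (hs h).le

/-- Uniqueness of the minimal-entropy `Π` over the optimal set `𝓜`: any two minimizers of
`f` over `B` whose `Π`-components minimize the entropy `H(Π) = ∑ i j, Π i j * log (Π i j)`
among all elements of `𝓜` have equal `Π`-components. -/
theorem minimal_entropy_Pi_unique
    (M N : ℕ) (hM : 0 < M) (hN : 0 < N)
    (p : Fin M → ℝ) (hp : ∀ i, p i ≥ 0) (hps : ∑ i, p i = 1)
    (d : Fin M → Fin N → ℝ) (hd : ∀ i j, d i j ≥ 0)
    (c : Fin M → Fin N → ℝ) (hc : ∀ i j, c i j ≥ 0)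
    (D : ℝ) (hD : D ≥ 0) (P : ℝ) (hP : P ≥ 0)
    (hB : ∃ w Pi : Fin M → Fin N → ℝ, ∃ r : Fin N → ℝ, memB p d c D P w Pi r)
    (𝓜 : Set ((Fin M → Fin N → ℝ) × (Fin M → Fin N → ℝ) × (Fin N → ℝ)))
    (h𝓜 : 𝓜 = {t | memB p d c D P t.1 t.2.1 t.2.2 ∧
      ∀ (w Pi : Fin M → Fin N → ℝ) (r : Fin N → ℝ),
        memB p d c D P w Pi r → fObj p t.1 t.2.2 ≤ fObj p w r})
    (w₁ Pi₁ : Fin M → Fin N → ℝ) (r₁ : Fin N → ℝ)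
    (w₂ Pi₂ : Fin M → Fin N → ℝ) (r₂ : Fin N → ℝ)
    (h₁ : (w₁, Pi₁, r₁) ∈ 𝓜) (h₂ : (w₂, Pi₂, r₂) ∈ 𝓜)
    (hmin₁ : ∀ t ∈ 𝓜, (∑ i, ∑ j, Pi₁ i j * Real.log (Pi₁ i j)) ≤
      ∑ i, ∑ j, t.2.1 i j * Real.log (t.2.1 i j))
    (hmin₂ : ∀ t ∈ 𝓜, (∑ i, ∑ j, Pi₂ i j * Real.log (Pi₂ i j)) ≤
      ∑ i, ∑ j, t.2.1 i j * Real.log (t.2.1 i j)) :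
    Pi₁ = Pi₂ := by
  subst h𝓜
  obtain ⟨m1, f1⟩ := h₁
  obtain ⟨m2, f2⟩ := h₂
  dsimp only at m1 f1 m2 f2
  have mm := aux_memB p d c D P w₁ Pi₁ w₂ Pi₂ r₁ r₂ m1 m2
  have hf := aux_fObj p hp w₁ w₂ r₁ r₂ m1.1.1 m2.1.1 m1.2.1 m2.2.1
  have h12 := f1 _ _ _ m2
  have h21 := f2 _ _ _ m1
  have g1 := hmin₁ (_, _, _) ⟨mm, fun w Pi r h => by
    have := f1 w Pi r h
    dsimp only
    linarith⟩
  have g2 := hmin₂ (_, _, _) ⟨mm, fun w Pi r h => by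
    have := f1 w Pi r h
    dsimp only
    linarith⟩
  dsimp only at g1 g2
  by_contra hne
  have : ∃ i j, Pi₁ i j ≠ Pi₂ i j := by
    by_contra hcon
    push Not at hcon
    exact hne (funext fun i => funext fun j => hcon i j)
  obtain ⟨i₀, j₀, hij⟩ := this
  have q := fun i j => aux_ent (Pi₁ i j) (Pi₂ i j) (m1.2.2.1.1 i j) (m2.2.2.1.1 i j)
  have hlt : ∑ i, ∑ j, (Pi₁ i j + Pi₂ i j) / 2 * Real.log ((Pi₁ i j + Pi₂ i j) / 2) <
      ∑ i, ∑ j, (Pi₁ i j * Real.log (Pi₁ i j) + Pi₂ i j * Real.log (Pi₂ i j)) / 2 :=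
    sum_lt_sum (fun i _ => sum_le_sum fun j _ => (q i j).1)
      ⟨i₀, mem_univ _, sum_lt_sum (fun j _ => (q i₀ j).1)
        ⟨j₀, mem_univ _, (q i₀ j₀).2 hij⟩⟩
  simp only [← sum_div, sum_add_distrib] at hlt
  linarith
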